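/- arXiv:1207.5394 — 11 statements merged into one kernel-verified Lean document; each statement's English description precedes it below -/
import Mathlib

section
/- Let δ be a triple derivation on a unital Jordan *-algebra A over ℂ. Then for all a, b ∈ A: (a) δ(a ∘ b) = (δ a) ∘ b + a ∘ (δ b) + ⦃a, δ 1, b⦄, and (b) δ(b*) = 2 (δ 1) ∘ b* + (δ b)*. -/
/-- The Jordan triple product `⦃x,y,z⦄ := (x∘y*)∘z + (z∘y*)∘x − (x∘z)∘y*` on a
Jordan *-algebra (whose ring multiplication is the Jordan product `∘`). -/
def jordanTriple {A : Type*} [NonAssocRing A] [Star A] (x y z : A) : A :=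
  x * star y * z + z * star y * x - x * z * star y

/-- Lemma: if `δ` is a triple derivation on a unital Jordan *-algebra `A` over `ℂ`, then
(a) `δ(a∘b) = δa∘b + a∘δb + ⦃a, δ1, b⦄` and (b) `δ(b*) = 2(δ1)∘b* + (δb)*`. -/
theorem triple_derivation_binary_and_star
    {A : Type*} [NonAssocRing A] [Module ℂ A] [SMulCommClass ℂ A A] [IsScalarTower ℂ A A]
    [StarRing A] [StarModule ℂ A]
    (hcomm : ∀ x y : A, x * y = y * x)
    (hjordan : ∀ x y : A, (x * y) * (x * x) = x * (y * (x * x)))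
    (δ : A →ₗ[ℂ] A)
    (hδ : ∀ x y z : A, δ (jordanTriple x y z) =
      jordanTriple (δ x) y z + jordanTriple x (δ y) z + jordanTriple x y (δ z)) :
    (∀ a b : A, δ (a * b) = δ a * b + a * δ b + jordanTriple a (δ 1) b) ∧
    (∀ b : A, δ (star b) = (2 : ℂ) • (δ 1 * star b) + star (δ b)) := by
  have triple_one_middle (a b : A) : jordanTriple a 1 b = a * b := by
    simp [jordanTriple, hcomm b a]
  have triple_one_left (b c : A) : jordanTriple 1 b c = c * star b := by
    simp [jordanTriple, hcomm (star b) c]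
  have triple_one_right (a b : A) : jordanTriple a b 1 = a * star b := by
    simp [jordanTriple, hcomm (star b) a]
  refine ⟨fun a b => ?_, fun b => ?_⟩
  · have h := hδ a 1 b
    rw [triple_one_middle, triple_one_middle, triple_one_middle] at h
    rw [h]
    abel
  · have h := hδ 1 b 1
    rw [triple_one_right, triple_one_right, triple_one_right, triple_one_left, one_mul,
      one_mul] at h
    rw [h, two_smul]
    abel
end

section
/- Let A be a unital Jordan *-algebra over ℂ and x ∈ A with x* = −x. Then the multiplication operator L_x : y ↦ x ∘ y is a triple derivation on A. -/
/-- Full linearization of the Jordan identity, over `ℂ`. -/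
theorem jordan_identity_linearized
    {A : Type*} [NonAssocRing A] [Module ℂ A]
    (hcomm : ∀ x y : A, x * y = y * x)
    (hjordan : ∀ x y : A, (x * y) * (x * x) = x * (y * (x * x)))
    (a b c d : A) :
    a * (b * c * d) + b * (a * c * d) + c * (a * b * d) =
      a * b * (c * d) + a * c * (b * d) + a * d * (b * c) := by
  have h₁ := hjordan (a + b + c) d
  have h₂ := hjordan (a + b) d
  have h₃ := hjordan (b + c) d
  have h₄ := hjordan (a + c) d
  have h₅ := hjordan a d
  have h₆ := hjordan b d
  have h₇ := hjordan c d
  simp only [add_mul, mul_add, hcomm] at h₁ h₂ h₃ h₄ h₅ h₆ h₇ ⊢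
  linear_combination (norm := module) (-1 / 2 : ℂ) • (h₁ - h₂ - h₃ - h₄ + h₅ + h₆ + h₇)

/-- If `x* = -x` in a unital Jordan *-algebra `A` over `ℂ`, then the multiplication
operator `L_x : y ↦ x ∘ y` is a triple derivation on `A`. -/
theorem mul_operator_is_triple_derivation_of_skew
    {A : Type*} [NonAssocRing A] [Module ℂ A] [SMulCommClass ℂ A A] [IsScalarTower ℂ A A]
    [StarRing A] [StarModule ℂ A]
    (hcomm : ∀ x y : A, x * y = y * x)
    (hjordan : ∀ x y : A, (x * y) * (x * x) = x * (y * (x * x)))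
    (x : A) (hx : star x = -x) :
    ∀ a b c : A, x * jordanTriple a b c =
      jordanTriple (x * a) b c + jordanTriple a (x * b) c + jordanTriple a b (x * c) := by
  intro a b c
  have h₁ := jordan_identity_linearized hcomm hjordan x a (star b) c
  have h₂ := jordan_identity_linearized hcomm hjordan x c (star b) a
  have h₃ := jordan_identity_linearized hcomm hjordan x a c (star b)
  simp only [jordanTriple, star_mul, hx, mul_add, mul_sub, mul_neg, neg_mul, hcomm]
    at h₁ h₂ h₃ ⊢
  linear_combination (norm := module) h₁ + h₂ - h₃
end

section
/- Let A be a unital Jordan *-algebra over ℂ whose triple product is non-degenerate, i.e. ⦃z,z,z⦄ = 0 implies z = 0. If the multiplication operator L_x : y ↦ x ∘ y is a triple derivation on A, then x* = −x. -/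
/-- In a unital Jordan *-algebra `A` over `ℂ` whose triple product is non-degenerate,
if the multiplication operator `L_x : y ↦ x ∘ y` is a triple derivation then `x* = -x`. -/
theorem skew_of_mul_operator_is_triple_derivation
    {A : Type*} [NonAssocRing A] [Module ℂ A] [SMulCommClass ℂ A A] [IsScalarTower ℂ A A]
    [StarRing A] [StarModule ℂ A]
    (hcomm : ∀ x y : A, x * y = y * x)
    (hjordan : ∀ x y : A, (x * y) * (x * x) = x * (y * (x * x)))
    (hnd : ∀ z : A, jordanTriple z z z = 0 → z = 0)
    (x : A)
    (hder : ∀ a b c : A, x * jordanTriple a b c =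
      jordanTriple (x * a) b c + jordanTriple a (x * b) c + jordanTriple a b (x * c)) :
    star x = -x := by
  have star_unit : star (1 : A) = 1 := by
    have h := star_mul (star (1 : A)) 1
    rwa [mul_one, star_star, mul_one, eq_comm] at h
  have h := hder 1 1 1
  simp only [jordanTriple, star_unit, mul_one, one_mul, add_sub_cancel_right] at h
  rw [add_assoc, left_eq_add] at h
  exact eq_neg_of_add_eq_zero_left h
end

section
/- Let δ be a triple derivation on a unital Jordan *-algebra A over ℂ. Then (δ 1)* = −δ 1, and the multiplication operator L_{δ1} : x ↦ (δ 1) ∘ x is also a triple derivation on A. -/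
/-- The linearised Jordan identity. Its left-hand side is symmetric in all four variables. -/
theorem jordan_linearization {A : Type*} [NonUnitalNonAssocCommRing A] [IsCommJordan A]
    [IsAddTorsionFree A] (a b c w : A) :
    a * b * (c * w) + a * c * (b * w) + a * w * (b * c) =
      a * (b * c * w) + b * (c * a * w) + c * (a * b * w) := by
  have h := congrArg (fun f : AddMonoid.End A => f w) (two_nsmul_lie_lmul_lmul_add_add_eq_zero a b c)
  simp only [Ring.lie_def] at h
  change 2 • (a * (b * c * w) - b * c * (a * w) + (b * (c * a * w) - c * a * (b * w))
    + (c * (a * b * w) - a * b * (c * w))) = 0 at h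
  have h' := (nsmul_eq_zero_iff_right two_ne_zero).mp h
  rw [mul_comm (b * c) (a * w), mul_comm c a] at h'
  rw [mul_comm c a, ← sub_eq_zero, ← neg_eq_zero, ← h']
  abel

/-- Left multiplication by `d` acts on the linear Jordan triple product as a derivation twisted by
a sign in the middle variable. -/
theorem jordan_mul_triple {A : Type*} [NonUnitalNonAssocCommRing A] [IsCommJordan A]
    [IsAddTorsionFree A] (d a b c : A) :
    d * (a * b * c + c * b * a - a * c * b) =
      (d * a * b * c + c * b * (d * a) - d * a * c * b)
        - (a * (d * b) * c + c * (d * b) * a - a * c * (d * b))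
        + (a * b * (d * c) + d * c * b * a - a * (d * c) * b) := by
  have ha := jordan_linearization b c d a
  have hb := jordan_linearization a c d b
  have hc := jordan_linearization a b d c
  simp only [mul_add, mul_sub, mul_comm] at ha hb hc ⊢
  grind

/-- If `δ` is a triple derivation on a unital Jordan *-algebra `A` over `ℂ`, then
`(δ1)* = -δ1` and the multiplication operator `L_{δ1} : x ↦ (δ1) ∘ x` is also a
triple derivation on `A`. -/
theorem triple_derivation_at_one
    {A : Type*} [NonAssocRing A] [Module ℂ A] [SMulCommClass ℂ A A] [IsScalarTower ℂ A A]
    [StarRing A] [StarModule ℂ A]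
    (hcomm : ∀ x y : A, x * y = y * x)
    (hjordan : ∀ x y : A, (x * y) * (x * x) = x * (y * (x * x)))
    (δ : A →ₗ[ℂ] A)
    (hδ : ∀ x y z : A, δ (jordanTriple x y z) =
      jordanTriple (δ x) y z + jordanTriple x (δ y) z + jordanTriple x y (δ z)) :
    star (δ 1) = -δ 1 ∧
    ∀ a b c : A, δ 1 * jordanTriple a b c =
      jordanTriple (δ 1 * a) b c + jordanTriple a (δ 1 * b) c + jordanTriple a b (δ 1 * c) := by
  have hstar : star (δ 1) = -δ 1 := by
    have h := hδ 1 1 1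
    simp only [jordanTriple, star_one, mul_one, one_mul, add_sub_cancel_right] at h
    rw [eq_neg_iff_add_eq_zero]
    simpa [add_assoc] using h
  refine ⟨hstar, fun a b c => ?_⟩
  let _ : NonUnitalNonAssocCommRing A := { ‹NonAssocRing A› with mul_comm := hcomm }
  have : IsCommJordan A := ⟨hjordan⟩
  have : IsAddTorsionFree A := .of_isTorsionFree ℂ A
  have h := jordan_mul_triple (δ 1) a (star b) c
  simp only [jordanTriple, star_mul, hstar, mul_neg, neg_mul, mul_comm (star b) (δ 1)]
  refine Eq.trans h ?_
  abel
end

section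
/- A ℂ-linear map δ on a unital Jordan *-algebra A over ℂ is a triple derivation if, and only if, both of the following hold: (i) δ(a ∘ b) = (δ a) ∘ b + a ∘ (δ b) + ⦃a, δ 1, b⦄ for all a, b ∈ A, and (ii) δ(b*) = 2 (δ 1) ∘ b* + (δ b)* for all b ∈ A. -/
/-- The linearized Jordan identity, evaluated at `w`. -/
theorem jordan_linearized {A : Type*} [NonUnitalNonAssocCommRing A] [IsCommJordan A]
    [IsAddTorsionFree A] (a b c w : A) :
    a * (b * c * w) + b * (c * a * w) + c * (a * b * w) =
      b * c * (a * w) + c * a * (b * w) + a * b * (c * w) := by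
  have h : a * (b * c * w) - b * c * (a * w) + (b * (c * a * w) - c * a * (b * w)) +
      (c * (a * b * w) - a * b * (c * w)) = 0 :=
    (smul_eq_zero_iff_right (two_ne_zero (α := ℕ))).1
      (DFunLike.congr_fun (two_nsmul_lie_lmul_lmul_add_add_eq_zero a b c) w)
  rw [← sub_eq_zero, ← h]
  abel

/-- Multiplication by `d` is a derivation of the linear Jordan triple product, up to the sign in
the middle variable. -/
theorem mul_linear_jordanTriple {A : Type*} [NonUnitalNonAssocCommRing A] [IsCommJordan A]
    [IsAddTorsionFree A] (d x y z : A) :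
    d * (x * y * z + z * y * x - x * z * y) =
      (d * x * y * z + z * y * (d * x) - d * x * z * y)
        - (x * (d * y) * z + z * (d * y) * x - x * z * (d * y))
        + (x * y * (d * z) + d * z * y * x - x * (d * z) * y) := by
  have hx := jordan_linearized d y z x
  have hy := jordan_linearized d x z y
  have hz := jordan_linearized d x y z
  simp only [mul_add, mul_sub, mul_comm] at hx hy hz ⊢
  linear_combination (norm := abel) hz + hx - hy

/-- A `ℂ`-linear map `δ` on a unital Jordan *-algebra `A` over `ℂ` is a triple derivation
if and only if (i) `δ(a∘b) = δa∘b + a∘δb + ⦃a, δ1, b⦄` for all `a, b` and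
(ii) `δ(b*) = 2(δ1)∘b* + (δb)*` for all `b`. -/
theorem triple_derivation_iff
    {A : Type*} [NonAssocRing A] [Module ℂ A] [SMulCommClass ℂ A A] [IsScalarTower ℂ A A]
    [StarRing A] [StarModule ℂ A]
    (hcomm : ∀ x y : A, x * y = y * x)
    (hjordan : ∀ x y : A, (x * y) * (x * x) = x * (y * (x * x)))
    (δ : A →ₗ[ℂ] A) :
    (∀ x y z : A, δ (jordanTriple x y z) =
      jordanTriple (δ x) y z + jordanTriple x (δ y) z + jordanTriple x y (δ z)) ↔
    ((∀ a b : A, δ (a * b) = δ a * b + a * δ b + jordanTriple a (δ 1) b) ∧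
     (∀ b : A, δ (star b) = (2 : ℂ) • (δ 1 * star b) + star (δ b))) := by
  constructor
  · intro h
    refine ⟨fun a b => ?_, fun b => ?_⟩
    · have := h a 1 b
      simp only [jordanTriple, star_one, mul_one] at this ⊢
      rw [hcomm b a, hcomm b (δ a), hcomm (δ b) a] at this
      simp only [add_sub_cancel_right] at this
      rw [this]
      abel
    · have := h 1 b 1
      simp only [jordanTriple, one_mul, mul_one, add_sub_cancel_right, hcomm (star b) (δ 1)]
        at this
      rw [this, two_smul]
      abel
  · rintro ⟨hi, hii⟩ x y z
    let : NonUnitalNonAssocCommRing A :=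
      { (inferInstance : NonUnitalNonAssocRing A) with mul_comm := hcomm }
    have : IsCommJordan A := ⟨hjordan⟩
    have : IsAddTorsionFree A := .of_isTorsionFree ℂ A
    have hd : star (δ 1) = -δ 1 := by
      have := hi 1 1
      simp only [jordanTriple, one_mul, mul_one, add_sub_cancel_right] at this
      linear_combination (norm := abel) -this
    obtain ⟨D, hD⟩ : ∃ D : A → A, ∀ a, δ a = δ 1 * a + D a :=
      ⟨fun a => δ a - δ 1 * a, fun a => (add_sub_cancel _ _).symm⟩
    have hmul : ∀ a b, D (a * b) = D a * b + a * D b := by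
      intro a b
      have := hi a b
      rw [hD (a * b), hD a, hD b, jordanTriple, hd] at this
      simp only [mul_add, add_mul, mul_neg, neg_mul] at this
      rw [hcomm a (δ 1), hcomm a (δ 1 * b), hcomm b (δ 1), hcomm (a * b) (δ 1)] at this
      linear_combination (norm := abel) this
    have hstar : ∀ b, D (star b) = star (D b) := by
      intro b
      have := hii b
      rw [hD (star b), hD b, star_add, star_mul, hd, two_smul, mul_neg,
        hcomm (star b) (δ 1)] at this
      linear_combination (norm := abel) this
    have hadd : ∀ a b, D (a + b) = D a + D b := by
      intro a b
      have := map_add δ a b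
      rw [hD (a + b), hD a, hD b, mul_add] at this
      linear_combination (norm := abel) this
    have hsub : ∀ a b, D (a - b) = D a - D b := by
      intro a b
      have := map_sub δ a b
      rw [hD (a - b), hD a, hD b, mul_sub] at this
      linear_combination (norm := abel) this
    have hstar_mul : star (δ 1 * y) = -(δ 1 * star y) := by
      rw [star_mul, hd, mul_neg, hcomm]
    have key := mul_linear_jordanTriple (δ 1) x (star y) z
    rw [hD (jordanTriple x y z), hD x, hD y, hD z]
    simp only [jordanTriple, star_add, hstar_mul, hadd, hsub, hmul, hstar] at key ⊢
    rw [key]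
    simp only [mul_add, add_mul, mul_neg, neg_mul]
    abel
end

section
/- Let A be a unital associative complex star algebra, and for a, b ∈ A define δ = M_{a,b} : A → A by δ(x) = x*a + b*x (associative products). Then: (1) δ satisfies δ(x ∘ y) = (δ x) ∘ y + x ∘ (δ y) + ⦃x, δ 1, y⦄ for all x, y ∈ A if and only if star(a + b) = −(a + b); and (2) δ satisfies δ(star x) = 2 (δ 1) ∘ star x + star(δ x) for all x ∈ A if and only if x*(a + star a) + (b + star b)*x = 0 for all x ∈ A. -/
/-- The triple product `⦃x,y,z⦄ := (x·y*·z + z·y*·x)/2` on an associative star algebra. -/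
noncomputable def tp {A : Type*} [Ring A] [Algebra ℂ A] [Star A] (x y z : A) : A :=
  (2 : ℂ)⁻¹ • (x * star y * z + z * star y * x)

/-- The Jordan product `x ∘ y := (xy + yx)/2` on an associative algebra. -/
noncomputable def jp {A : Type*} [Ring A] [Algebra ℂ A] (x y : A) : A :=
  (2 : ℂ)⁻¹ • (x * y + y * x)

/-- The map `M_{a,b} : x ↦ xa + bx`. -/
def Mab {A : Type*} [Ring A] (a b : A) : A → A := fun x => x * a + b * x

theorem jp_add_jp_add_tp_sub_Mab_jp {A : Type*} [Ring A] [Algebra ℂ A] [StarRing A]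
    (a b x y : A) :
    jp (Mab a b x) y + jp x (Mab a b y) + tp x (Mab a b 1) y - Mab a b (jp x y) =
      (2 : ℂ)⁻¹ • (x * (star (a + b) + (a + b)) * y + y * (star (a + b) + (a + b)) * x) := by
  simp only [jp, tp, Mab, smul_mul_assoc, mul_smul_comm, ← smul_add, ← smul_sub, one_mul, mul_one]
  congr 1
  noncomm_ring

theorem star_two_smul_jp_add_star_sub_Mab_star {A : Type*} [Ring A] [Algebra ℂ A] [StarRing A]
    (a b x : A) :
    star ((2 : ℂ) • jp (Mab a b 1) (star x) + star (Mab a b x) - Mab a b (star x)) =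
      x * (a + star a) + (b + star b) * x := by
  simp only [jp, Mab, smul_inv_smul₀ (two_ne_zero' ℂ), one_mul, mul_one, star_add, star_sub,
    star_mul, star_star]
  noncomm_ring

/-- For `δ = M_{a,b}` on a unital associative complex star algebra:
(1) `δ(x∘y) = δx∘y + x∘δy + ⦃x, δ1, y⦄` for all `x,y` iff `(a+b)* = -(a+b)`;
(2) `δ(x*) = 2(δ1)∘x* + (δx)*` for all `x` iff `x(a+a*) + (b+b*)x = 0` for all `x`. -/
theorem Mab_conditions
    {A : Type*} [Ring A] [Algebra ℂ A] [StarRing A] [StarModule ℂ A] (a b : A) :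
    ((∀ x y : A, Mab a b (jp x y) =
        jp (Mab a b x) y + jp x (Mab a b y) + tp x (Mab a b 1) y) ↔
      star (a + b) = -(a + b)) ∧
    ((∀ x : A, Mab a b (star x) =
        (2 : ℂ) • jp (Mab a b 1) (star x) + star (Mab a b x)) ↔
      ∀ x : A, x * (a + star a) + (b + star b) * x = 0) := by
  refine ⟨⟨fun h => ?_, fun h x y => ?_⟩, forall_congr' fun x => ?_⟩
  · have key := jp_add_jp_add_tp_sub_Mab_jp a b 1 1
    rw [← h, sub_self, one_mul, mul_one, ← two_smul ℂ (star (a + b) + (a + b)),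
      inv_smul_smul₀ (two_ne_zero' ℂ)] at key
    exact eq_neg_of_add_eq_zero_left key.symm
  · refine (sub_eq_zero.mp ?_).symm
    rw [jp_add_jp_add_tp_sub_Mab_jp, h]
    simp
  · rw [← star_two_smul_jp_add_star_sub_Mab_star, star_eq_zero, sub_eq_zero, eq_comm]
end

section
/- Let A be a unital Jordan *-algebra over ℂ. For every x ∈ A, the pair (L_x, L_{−x*}) of multiplication operators (L_a : y ↦ a ∘ y) is a derivation pair on A. Moreover, if the triple product of A is non-degenerate (⦃z,z,z⦄ = 0 implies z = 0) and (L_x, L_y) is a derivation pair, then y = −x*. -/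
/-- A derivation pair on a Jordan *-algebra: a pair of maps `(d₊, d₋)` with
`d₊⦃x,y,z⦄ = ⦃d₊x,y,z⦄ + ⦃x,d₋y,z⦄ + ⦃x,y,d₊z⦄` and
`d₋⦃x,y,z⦄ = ⦃d₋x,y,z⦄ + ⦃x,d₊y,z⦄ + ⦃x,y,d₋z⦄`. -/
def IsDerivationPair {A : Type*} [NonAssocRing A] [Star A] (dp dm : A → A) : Prop :=
  (∀ x y z : A, dp (jordanTriple x y z) =
    jordanTriple (dp x) y z + jordanTriple x (dm y) z + jordanTriple x y (dp z)) ∧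
  (∀ x y z : A, dm (jordanTriple x y z) =
    jordanTriple (dm x) y z + jordanTriple x (dp y) z + jordanTriple x y (dm z))

/-- The linearised Jordan identity, evaluated at `d`. -/
theorem jordan_linearized_s12 {A : Type*} [NonAssocRing A] [Module ℂ A]
    (hcomm : ∀ x y : A, x * y = y * x)
    (hjordan : ∀ x y : A, (x * y) * (x * x) = x * (y * (x * x))) (a b c d : A) :
    a * (b * c * d) + b * (c * a * d) + c * (a * b * d) =
      b * c * (a * d) + c * a * (b * d) + a * b * (c * d) := by
  let _ : NonUnitalNonAssocCommRing A :=
    { (inferInstance : NonUnitalNonAssocRing A) with mul_comm := hcomm }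
  have : IsCommJordan A := ⟨hjordan⟩
  have h := DFunLike.congr_fun (two_nsmul_lie_lmul_lmul_add_add_eq_zero a b c) d
  have h2 : (2 : ℂ) • ((a * (b * c * d) + b * (c * a * d) + c * (a * b * d)) -
      (b * c * (a * d) + c * a * (b * d) + a * b * (c * d))) = 0 := by
    rw [two_smul, ← two_nsmul, ← AddMonoidHom.zero_apply (M := A) (N := A) d]
    refine Eq.trans ?_ h
    change _ = 2 • ((a * (b * c * d) - b * c * (a * d)) + (b * (c * a * d) - c * a * (b * d)) +
      (c * (a * b * d) - a * b * (c * d)))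
    congr 1
    abel
  exact sub_eq_zero.mp ((smul_eq_zero.mp h2).resolve_left two_ne_zero)

/-- Multiplication by `a` acts on the triple product as a derivation up to a sign in the
middle variable. -/
theorem mul_jordanTriple {A : Type*} [NonAssocRing A] [Module ℂ A] [StarRing A]
    (hcomm : ∀ x y : A, x * y = y * x)
    (hjordan : ∀ x y : A, (x * y) * (x * x) = x * (y * (x * x))) (a x y z : A) :
    a * jordanTriple x y z =
      jordanTriple (a * x) y z + jordanTriple x (-star a * y) z + jordanTriple x y (a * z) := by
  have hs : star (-star a * y) = -(a * star y) := by
    rw [star_mul, star_neg, star_star, mul_neg, hcomm]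
  simp only [jordanTriple, hs]
  simp only [mul_add, mul_sub, mul_neg, neg_mul]
  generalize star y = b
  have hb := jordan_linearized_s12 hcomm hjordan a x z b
  have hz := jordan_linearized_s12 hcomm hjordan a x b z
  have hx := jordan_linearized_s12 hcomm hjordan a z b x
  clear hjordan hs
  grind

/-- In a unital Jordan *-algebra `A` over `ℂ`, for every `x` the pair `(L_x, L_{-x*})` of
multiplication operators is a derivation pair; moreover, if the triple product is
non-degenerate and `(L_x, L_y)` is a derivation pair, then `y = -x*`. -/
theorem mul_operators_derivation_pair
    {A : Type*} [NonAssocRing A] [Module ℂ A] [SMulCommClass ℂ A A] [IsScalarTower ℂ A A]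
    [StarRing A] [StarModule ℂ A]
    (hcomm : ∀ x y : A, x * y = y * x)
    (hjordan : ∀ x y : A, (x * y) * (x * x) = x * (y * (x * x))) :
    (∀ x : A, IsDerivationPair (fun a => x * a) (fun a => -star x * a)) ∧
    ((∀ z : A, jordanTriple z z z = 0 → z = 0) → ∀ x y : A,
      IsDerivationPair (fun a => x * a) (fun a => y * a) → y = -star x) := by
  refine ⟨fun x => ⟨fun a b c => mul_jordanTriple hcomm hjordan x a b c, fun a b c => ?_⟩,
    fun _ x y h => ?_⟩
  · have h := mul_jordanTriple hcomm hjordan (-star x) a b c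
    rwa [star_neg, star_star, neg_neg] at h
  · have h1 := h.1 1 1 1
    simp only [jordanTriple, star_one, mul_one, one_mul, add_sub_cancel_right] at h1
    have h2 : star y = -x := by
      rw [eq_neg_iff_add_eq_zero, add_comm]
      exact add_right_cancel (b := x) (by rw [zero_add]; exact h1.symm)
    rw [← star_star y, h2, star_neg]
end

section
/- Let A be a unital associative complex star algebra, let δ : A → A be a local triple derivation, and let Λ ⊆ A be a family of pairwise orthogonal tripotents. Then for all e, f, g ∈ Λ (not necessarily distinct): δ⦃e,f,g⦄ = ⦃δe, f, g⦄ + ⦃e, δf, g⦄ + ⦃e, f, δg⦄. -/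
/-- A triple derivation: a `ℂ`-linear map `δ` with
`δ⦃x,y,z⦄ = ⦃δx,y,z⦄ + ⦃x,δy,z⦄ + ⦃x,y,δz⦄` for all `x,y,z`. -/
def IsTripleDerivation {A : Type*} [Ring A] [Algebra ℂ A] [Star A] (δ : A →ₗ[ℂ] A) : Prop :=
  ∀ x y z : A, δ (tp x y z) = tp (δ x) y z + tp x (δ y) z + tp x y (δ z)

/-- A local triple derivation agrees at each point with some triple derivation. -/
def IsLocalTripleDerivation {A : Type*} [Ring A] [Algebra ℂ A] [Star A]
    (δ : A →ₗ[ℂ] A) : Prop :=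
  ∀ x : A, ∃ T : A →ₗ[ℂ] A, IsTripleDerivation T ∧ T x = δ x

section TripleProduct

variable {A : Type*} [Ring A] [Algebra ℂ A]

theorem tp_comm [Star A] (x y z : A) : tp x y z = tp z y x := by
  simp only [tp, add_comm]

theorem tp_self [Star A] {e : A} (he : e * star e * e = e) : tp e e e = e := by
  rw [tp, he]
  module

/-- The triple product vanishes when its last two entries are orthogonal. -/
theorem tp_eq_zero_of_orthogonal [StarRing A] {f g : A} (h₁ : g * star f = 0)
    (h₂ : star f * g = 0) (x : A) : tp x f g = 0 := by
  simp [tp, mul_assoc x, h₁, h₂]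

section Additivity

variable [StarRing A]

theorem tp_add_left (x x' y z : A) : tp (x + x') y z = tp x y z + tp x' y z := by
  simp only [tp, add_mul, mul_add]
  module

theorem tp_add_right (x y z z' : A) : tp x y (z + z') = tp x y z + tp x y z' := by
  simp only [tp, add_mul, mul_add]
  module

theorem tp_add_middle (x y y' z : A) : tp x (y + y') z = tp x y z + tp x y' z := by
  simp only [tp, star_add, add_mul, mul_add]
  module

theorem tp_neg_left (x y z : A) : tp (-x) y z = -tp x y z := by
  simp only [tp, neg_mul, mul_neg]
  module

theorem tp_neg_right (x y z : A) : tp x y (-z) = -tp x y z := by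
  simp only [tp, neg_mul, mul_neg]
  module

theorem tp_neg_middle (x y z : A) : tp x (-y) z = -tp x y z := by
  simp only [tp, star_neg, neg_mul, mul_neg]
  module

end Additivity

namespace IsLocalTripleDerivation

/-- A local triple derivation satisfies the derivation identity at a single tripotent. -/
theorem apply_tripotent [Star A] {δ : A →ₗ[ℂ] A} (hδ : IsLocalTripleDerivation δ) {e : A}
    (he : e * star e * e = e) : δ e = tp (δ e) e e + tp e (δ e) e + tp e e (δ e) := by
  obtain ⟨T, hT, hTe⟩ := hδ e
  simpa only [tp_self he, hTe] using hT e e e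

theorem tp_middle_eq_zero [StarRing A] {δ : A →ₗ[ℂ] A} (hδ : IsLocalTripleDerivation δ)
    {e f g : A} (he₁ : e * star f = 0) (he₂ : star f * e = 0) (hg₁ : g * star f = 0)
    (hg₂ : star f * g = 0) : tp e (δ f) g = 0 := by
  obtain ⟨T, hT, hTf⟩ := hδ f
  have h := hT e f g
  rw [hTf, tp_comm e f (T g)] at h
  simpa only [tp_eq_zero_of_orthogonal hg₁ hg₂, tp_eq_zero_of_orthogonal he₁ he₂, map_zero,
    zero_add, add_zero, eq_comm] using h

/-- For orthogonal tripotents `e`, `g`, the derivation identity holds at `(e, e, g)`. -/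
theorem tp_self_left [StarRing A] {δ : A →ₗ[ℂ] A} (hδ : IsLocalTripleDerivation δ)
    {e g : A} (he : e * star e * e = e) (hg : g * star g * g = g)
    (heg₁ : e * star g = 0) (heg₂ : star g * e = 0)
    (hge₁ : g * star e = 0) (hge₂ : star e * g = 0) :
    tp e (δ e) g + tp e e (δ g) = 0 := by
  have hadd : (g + e) * star (g + e) * (g + e) = g + e := by
    simp only [star_add, mul_add, add_mul, heg₁, hge₁, mul_assoc, heg₂, hge₂, mul_zero]
    simp only [← mul_assoc, he, hg, zero_mul, add_zero, zero_add]
  have hsub : (g + -e) * star (g + -e) * (g + -e) = g + -e := by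
    simp only [star_add, star_neg, mul_add, add_mul, neg_mul, mul_neg, heg₁, hge₁, mul_assoc,
      heg₂, hge₂, mul_zero]
    simp only [← mul_assoc, he, hg, zero_mul, add_zero, zero_add, neg_zero, neg_neg]
  have h₁ := hδ.apply_tripotent hadd
  have h₂ := hδ.apply_tripotent hsub
  have h₃ := hδ.apply_tripotent hg
  have zg := tp_eq_zero_of_orthogonal hge₁ hge₂
  have ze := tp_eq_zero_of_orthogonal heg₁ heg₂
  have zg' (x : A) : tp g e x = 0 := by rw [tp_comm, zg]
  have ze' (x : A) : tp e g x = 0 := by rw [tp_comm, ze]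
  have me := hδ.tp_middle_eq_zero heg₁ heg₂ heg₁ heg₂
  simp only [map_add, map_neg, tp_add_left, tp_add_middle, tp_add_right, tp_neg_left,
    tp_neg_middle, tp_neg_right, zg, ze, zg', ze', me] at h₁ h₂
  have c₁ := tp_comm e (δ e) g
  have c₂ := tp_comm e e (δ g)
  linear_combination (norm := module) (-(1 / 4 : ℂ)) • h₁ + (-(1 / 4 : ℂ)) • h₂ + (1 / 2 : ℂ) • h₃
    + (1 / 2 : ℂ) • c₁ + (1 / 2 : ℂ) • c₂

end IsLocalTripleDerivation

end TripleProduct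

/-- A local triple derivation acts as a derivation on triple products of members of a
family of pairwise orthogonal tripotents. -/
theorem local_triple_derivation_on_orthogonal_tripotents
    {A : Type*} [Ring A] [Algebra ℂ A] [StarRing A] [StarModule ℂ A]
    (δ : A →ₗ[ℂ] A) (hδ : IsLocalTripleDerivation δ)
    (Λ : Set A)
    (htri : ∀ e ∈ Λ, e * star e * e = e)
    (horth : ∀ e ∈ Λ, ∀ f ∈ Λ, e ≠ f → e * star f = 0 ∧ star f * e = 0) :
    ∀ e ∈ Λ, ∀ f ∈ Λ, ∀ g ∈ Λ,
      δ (tp e f g) = tp (δ e) f g + tp e (δ f) g + tp e f (δ g) := by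
  intro e he f hf g hg
  by_cases hef : e = f
  · subst hef
    by_cases heg : e = g
    · subst heg
      rw [tp_self (htri e he)]
      exact hδ.apply_tripotent (htri e he)
    · obtain ⟨a, b⟩ := horth e he g hg heg
      obtain ⟨c, d⟩ := horth g hg e he (Ne.symm heg)
      rw [tp_eq_zero_of_orthogonal c d, tp_eq_zero_of_orthogonal c d, map_zero, zero_add,
        hδ.tp_self_left (htri e he) (htri g hg) a b c d]
  · obtain ⟨a, b⟩ := horth e he f hf hef
    by_cases hgf : g = f
    · subst hgf
      obtain ⟨c, d⟩ := horth g hg e he (Ne.symm hef)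
      rw [tp_comm e g g, tp_comm e g (δ g), tp_comm e (δ g) g, tp_comm (δ e),
        tp_eq_zero_of_orthogonal a b, tp_eq_zero_of_orthogonal a b, map_zero, add_zero, add_comm,
        hδ.tp_self_left (htri g hg) (htri e he) c d a b]
    · obtain ⟨c, d⟩ := horth g hg f hf hgf
      rw [tp_comm e f (δ g), tp_eq_zero_of_orthogonal c d, tp_eq_zero_of_orthogonal c d,
        tp_eq_zero_of_orthogonal a b, hδ.tp_middle_eq_zero a b c d]
      simp
end

section
/- Let A be a unital associative complex star algebra, let δ : A → A be a local triple derivation, and let Λ ⊆ A be a family of pairwise orthogonal tripotents. Then for all x, y, z in the ℂ-linear span of Λ: δ⦃x,y,z⦄ = ⦃δx, y, z⦄ + ⦃x, δy, z⦄ + ⦃x, y, δz⦄. -/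
open ComplexConjugate in
/-- A map on triples that is additive and homogeneous in the first argument, additive and
conjugate-homogeneous in the second one, and symmetric in the outer arguments. -/
structure IsTripleForm {A : Type*} [AddCommGroup A] [Module ℂ A] (D : A → A → A → A) : Prop where
  add_left : ∀ x x' y z, D (x + x') y z = D x y z + D x' y z
  smul_left : ∀ (c : ℂ) x y z, D (c • x) y z = c • D x y z
  add_middle : ∀ x y y' z, D x (y + y') z = D x y z + D x y' z
  smul_middle : ∀ (c : ℂ) x y z, D x (c • y) z = conj c • D x y z
  symm : ∀ x y z, D x y z = D z y x

namespace IsTripleForm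

variable {A : Type*} [AddCommGroup A] [Module ℂ A] {D : A → A → A → A}

theorem add_right (h : IsTripleForm D) (x y z z' : A) :
    D x y (z + z') = D x y z + D x y z' := by
  rw [h.symm, h.add_left, h.symm z, h.symm z']

theorem smul_right (h : IsTripleForm D) (c : ℂ) (x y z : A) :
    D x y (c • z) = c • D x y z := by
  rw [h.symm, h.smul_left, h.symm z]

/-- Polarization in two variables with unimodular coefficients. -/
theorem polarization₂ (h : IsTripleForm D) {e f : A} (he : D e e e = 0) (hf : D f f f = 0)
    (hu : ∀ a : ℂ, ‖a‖ = 1 → D (e + a • f) (e + a • f) (e + a • f) = 0) :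
    D e e f = 0 ∧ D e f e = 0 := by
  have h₁ := hu 1 (by simp)
  have h₂ := hu (-1) (by simp)
  have h₃ := hu Complex.I (by simp)
  have h₄ := hu (-Complex.I) (by simp)
  simp only [h.add_left, h.add_middle, h.add_right, h.smul_left, h.smul_middle, h.smul_right,
    he, hf, h.symm f e e, h.symm e f f, map_neg, map_one, Complex.conj_I, smul_smul, smul_zero,
    add_zero, zero_add, neg_mul, mul_neg, neg_neg, Complex.I_mul_I, mul_one]
    at h₁ h₂ h₃ h₄
  have h₅ : Complex.I • ((2 : ℂ) • D e e f - D e f e) = 0 := by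
    linear_combination (norm := module) (2 : ℂ)⁻¹ • h₃ - (2 : ℂ)⁻¹ • h₄
  have h₆ := (smul_eq_zero_iff_right Complex.I_ne_zero).mp h₅
  constructor
  · linear_combination (norm := module) (8 : ℂ)⁻¹ • h₁ - (8 : ℂ)⁻¹ • h₂ + (4 : ℂ)⁻¹ • h₆
  · linear_combination (norm := module) (4 : ℂ)⁻¹ • h₁ - (4 : ℂ)⁻¹ • h₂ - (2 : ℂ)⁻¹ • h₆

/-- Polarization in three variables with unimodular coefficients. -/
theorem polarization₃ (h : IsTripleForm D) {e f g : A}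
    (h₂ : ∀ x ∈ ({e, f, g} : Set A), ∀ y ∈ ({e, f, g} : Set A), D x x y = 0 ∧ D x y x = 0)
    (hu : ∀ a b : ℂ, ‖a‖ = 1 → ‖b‖ = 1 →
      D (a • e + f + b • g) (a • e + f + b • g) (a • e + f + b • g) = 0) :
    D e f g = 0 := by
  have h₁ := hu Complex.I 1 (by simp) (by simp)
  have h₃ := hu 1 Complex.I (by simp) (by simp)
  have hl : ∀ x ∈ ({e, f, g} : Set A), ∀ y ∈ ({e, f, g} : Set A), D x x y = 0 :=
    fun x hx y hy => (h₂ x hx y hy).1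
  have hm : ∀ x ∈ ({e, f, g} : Set A), ∀ y ∈ ({e, f, g} : Set A), D x y x = 0 :=
    fun x hx y hy => (h₂ x hx y hy).2
  have hr : ∀ x ∈ ({e, f, g} : Set A), ∀ y ∈ ({e, f, g} : Set A), D y x x = 0 :=
    fun x hx y hy => (h.symm y x x).trans (hl x hx y hy)
  simp only [Set.mem_insert_iff, Set.mem_singleton_iff, forall_eq_or_imp, forall_eq] at hl hm hr
  simp only [h.add_left, h.add_middle, h.add_right, h.smul_left, h.smul_middle, h.smul_right,
    hl, hm, hr, h.symm g f e, h.symm g e f, h.symm f g e, Complex.conj_I, one_smul,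
    smul_zero, add_zero, zero_add] at h₁ h₃
  have h₄ : Complex.I • D e f g = 0 := by
    linear_combination (norm := module) (4 : ℂ)⁻¹ • h₁ + (4 : ℂ)⁻¹ • h₃
  exact (smul_eq_zero_iff_right Complex.I_ne_zero).mp h₄

/-- A triple form that vanishes on triples from a set vanishes on triples from its span. -/
theorem eq_zero_of_mem_span (h : IsTripleForm D) {s : Set A}
    (hs : ∀ x ∈ s, ∀ y ∈ s, ∀ z ∈ s, D x y z = 0) :
    ∀ x ∈ Submodule.span ℂ s, ∀ y ∈ Submodule.span ℂ s, ∀ z ∈ Submodule.span ℂ s,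
      D x y z = 0 := by
  have zero_left : ∀ y z, D 0 y z = 0 := fun y z => by simpa using h.smul_left 0 0 y z
  have zero_middle : ∀ x z, D x 0 z = 0 := fun x z => by simpa using h.smul_middle 0 x 0 z
  have key : ∀ y z, (∀ x ∈ s, D x y z = 0) → ∀ x ∈ Submodule.span ℂ s, D x y z = 0 := by
    intro y z hyz x hx
    induction hx using Submodule.span_induction with
    | mem x hx => exact hyz x hx
    | zero => exact zero_left y z
    | add x x' _ _ hx hx' => rw [h.add_left, hx, hx', add_zero]
    | smul c x _ hx => rw [h.smul_left, hx, smul_zero]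
  intro x hx y hy z hz
  refine key y z (fun x hx => ?_) x hx
  rw [h.symm]
  refine key y x (fun z hz => ?_) z hz
  induction hy using Submodule.span_induction with
  | mem y hy => exact hs z hz y hy x hx
  | zero => exact zero_middle z x
  | add y y' _ _ hy hy' => rw [h.add_middle, hy, hy', add_zero]
  | smul c y _ hy => rw [h.smul_middle, hy, smul_zero]

end IsTripleForm


section TripleProduct

variable {A : Type*} [Ring A] [Algebra ℂ A] [StarRing A]

/-- The defect of a linear map from being a triple derivation. -/
noncomputable def tripleDefect (δ : A →ₗ[ℂ] A) (x y z : A) : A :=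
  δ (tp x y z) - (tp (δ x) y z + tp x (δ y) z + tp x y (δ z))

theorem isTripleForm_tripleDefect [StarModule ℂ A] (δ : A →ₗ[ℂ] A) :
    IsTripleForm (tripleDefect δ) where
  add_left x x' y z := by
    simp only [tripleDefect, tp, map_add, map_smul, add_mul, mul_add]
    module
  smul_left c x y z := by
    simp only [tripleDefect, tp, map_add, map_smul, smul_mul_assoc, mul_smul_comm]
    module
  add_middle x y y' z := by
    simp only [tripleDefect, tp, map_add, map_smul, star_add, add_mul, mul_add]
    module
  smul_middle c x y z := by
    simp only [tripleDefect, tp, map_add, map_smul, star_smul, smul_mul_assoc, mul_smul_comm,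
      starRingEnd_apply]
    module
  symm x y z := by
    simp only [tripleDefect, tp, map_add, map_smul]
    module

theorem tp_self_of_tripotent {u : A} (hu : u * star u * u = u) : tp u u u = u := by
  rw [tp, hu]
  module

theorem IsLocalTripleDerivation.tripleDefect_self {δ : A →ₗ[ℂ] A}
    (hδ : IsLocalTripleDerivation δ) {u : A} (hu : u * star u * u = u) :
    tripleDefect δ u u u = 0 := by
  obtain ⟨T, hT, hTu⟩ := hδ u
  have h := hT u u u
  rw [tp_self_of_tripotent hu, hTu] at h
  rw [tripleDefect, tp_self_of_tripotent hu, sub_eq_zero]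
  exact h

theorem tripotent_smul [StarModule ℂ A] {u : A} (hu : u * star u * u = u) {a : ℂ}
    (ha : ‖a‖ = 1) : (a • u) * star (a • u) * (a • u) = a • u := by
  have h : a * star a = 1 := by
    simpa [ha] using Complex.mul_conj' a
  simp only [star_smul, smul_mul_assoc, mul_smul_comm, smul_smul, hu]
  rw [mul_comm (star a), h, mul_one]

theorem tripotent_add {A : Type*} [Ring A] [StarRing A] {u v : A}
    (hu : u * star u * u = u) (hv : v * star v * v = v)
    (h₁ : u * star v = 0) (h₂ : star v * u = 0) :
    (u + v) * star (u + v) * (u + v) = u + v := by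
  have h₃ : v * star u = 0 := by simpa using congrArg star h₁
  have h₄ : star u * v = 0 := by simpa using congrArg star h₂
  simp only [star_add, add_mul, mul_add, h₁, h₃, mul_assoc, h₂, h₄, mul_zero, add_zero, zero_add]
  rw [← mul_assoc, ← mul_assoc v, hu, hv]

end TripleProduct

/-- A local triple derivation acts as a derivation on triple products of elements of the
span of a family of pairwise orthogonal tripotents. -/
theorem local_triple_derivation_on_span_of_orthogonal_tripotents
    {A : Type*} [Ring A] [Algebra ℂ A] [StarRing A] [StarModule ℂ A]
    (δ : A →ₗ[ℂ] A) (hδ : IsLocalTripleDerivation δ)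
    (Λ : Set A)
    (htri : ∀ e ∈ Λ, e * star e * e = e)
    (horth : ∀ e ∈ Λ, ∀ f ∈ Λ, e ≠ f → e * star f = 0 ∧ star f * e = 0) :
    ∀ x ∈ Submodule.span ℂ Λ, ∀ y ∈ Submodule.span ℂ Λ, ∀ z ∈ Submodule.span ℂ Λ,
      δ (tp x y z) = tp (δ x) y z + tp x (δ y) z + tp x y (δ z) := by
  have hD := isTripleForm_tripleDefect δ
  have hdiag : ∀ e ∈ Λ, tripleDefect δ e e e = 0 := fun e he => hδ.tripleDefect_self (htri e he)
  have hpair : ∀ e ∈ Λ, ∀ f ∈ Λ, tripleDefect δ e e f = 0 ∧ tripleDefect δ e f e = 0 := by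
    intro e he f hf
    rcases eq_or_ne e f with rfl | hef
    · exact ⟨hdiag e he, hdiag e he⟩
    · obtain ⟨h₁, h₂⟩ := horth e he f hf hef
      exact hD.polarization₂ (hdiag e he) (hdiag f hf) fun a ha =>
        hδ.tripleDefect_self <| tripotent_add (htri e he) (tripotent_smul (htri f hf) ha)
          (by simp [h₁]) (by simp [h₂])
  have hzero : ∀ e ∈ Λ, ∀ f ∈ Λ, ∀ g ∈ Λ, tripleDefect δ e f g = 0 := by
    intro e he f hf g hg
    rcases eq_or_ne e f with rfl | hef
    · exact (hpair e he g hg).1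
    rcases eq_or_ne e g with rfl | heg
    · exact (hpair e he f hf).2
    rcases eq_or_ne f g with rfl | hfg
    · exact (hD.symm e f f).trans (hpair f hf e he).1
    have hsub : ({e, f, g} : Set A) ⊆ Λ := by
      rintro x (rfl | rfl | rfl) <;> assumption
    obtain ⟨h₁, h₂⟩ := horth e he f hf hef
    obtain ⟨h₃, h₄⟩ := horth e he g hg heg
    obtain ⟨h₅, h₆⟩ := horth f hf g hg hfg
    refine hD.polarization₃ (fun x hx y hy => hpair x (hsub hx) y (hsub hy)) fun a b ha hb =>
      hδ.tripleDefect_self ?_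
    refine tripotent_add (tripotent_add (tripotent_smul (htri e he) ha) (htri f hf) ?_ ?_)
      (tripotent_smul (htri g hg) hb) ?_ ?_ <;>
    simp [add_mul, mul_add, h₁, h₂, h₃, h₄, h₅, h₆]
  intro x hx y hy z hz
  exact sub_eq_zero.mp (hD.eq_zero_of_mem_span hzero x hx y hy z hz)
end

section
/- Let A be a unital associative complex star algebra and let δ : A → A be a ℂ-linear map satisfying δ⦃x,x,x⦄ = 2⦃δx, x, x⦄ + ⦃x, δx, x⦄ for every x ∈ A. Then δ is a triple derivation: δ⦃x,y,z⦄ = ⦃δx, y, z⦄ + ⦃x, δy, z⦄ + ⦃x, y, δz⦄ for all x, y, z ∈ A. -/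
/-- Polarisation: a map that is linear in its outer variables, conjugate-linear in its middle
variable and symmetric in its outer variables vanishes if it vanishes on the diagonal. -/
theorem eq_zero_of_diagonal_eq_zero {E F : Type*} [AddCommGroup E] [Module ℂ E]
    [AddCommGroup F] [Module ℂ F] (T : E → E → E → F)
    (symm : ∀ x y z, T x y z = T z y x)
    (add_left : ∀ x x' y z, T (x + x') y z = T x y z + T x' y z)
    (add_middle : ∀ x y y' z, T x (y + y') z = T x y z + T x y' z)
    (smul_left : ∀ (c : ℂ) x y z, T (c • x) y z = c • T x y z)
    (smul_middle : ∀ (c : ℂ) x y z, T x (c • y) z = star c • T x y z)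
    (diag : ∀ x, T x x x = 0) (x y z : E) : T x y z = 0 := by
  have add_right (x y z z') : T x y (z + z') = T x y z + T x y z' := by
    rw [symm, add_left, symm z, symm z']
  have smul_right (c : ℂ) (x y z) : T x y (c • z) = c • T x y z := by
    rw [symm, smul_left, symm z]
  have linear_part (x y) : (2 : ℂ) • T x x y + T x y x = 0 := by
    have hp := diag (x + y)
    have hm := diag (x + (-1 : ℂ) • y)
    simp only [add_left, add_middle, add_right, smul_left, smul_middle, smul_right, diag,
      symm y x x, symm y y x, star_neg, star_one] at hp hm
    linear_combination (norm := module) (2⁻¹ : ℂ) • hp - (2⁻¹ : ℂ) • hm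
  have middle (x y) : T x y x = 0 := by
    have h₁ := linear_part x y
    have h₂ := linear_part x (Complex.I • y)
    simp only [smul_middle, smul_right, Complex.star_def, Complex.conj_I] at h₂
    have h₃ : (2 * Complex.I) • T x y x = 0 := by
      linear_combination (norm := module) Complex.I • h₁ - h₂
    exact (smul_eq_zero.mp h₃).resolve_left (by simp)
  have h₁ := middle (x + z) y
  simp only [add_left, add_right, middle, symm z y x] at h₁
  linear_combination (norm := module) (2⁻¹ : ℂ) • h₁

/-- Polarisation: a `ℂ`-linear map `δ` on a unital associative complex star algebra
satisfying `δ⦃x,x,x⦄ = 2⦃δx,x,x⦄ + ⦃x,δx,x⦄` for all `x` is a triple derivation. -/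
theorem triple_derivation_of_cube_identity
    {A : Type*} [Ring A] [Algebra ℂ A] [StarRing A] [StarModule ℂ A]
    (δ : A →ₗ[ℂ] A)
    (h : ∀ x : A, δ (tp x x x) = (2 : ℂ) • tp (δ x) x x + tp x (δ x) x) :
    ∀ x y z : A, δ (tp x y z) = tp (δ x) y z + tp x (δ y) z + tp x y (δ z) := by
  intro x y z
  rw [← sub_eq_zero]
  refine eq_zero_of_diagonal_eq_zero
    (fun x y z => δ (tp x y z) - (tp (δ x) y z + tp x (δ y) z + tp x y (δ z)))
    ?_ ?_ ?_ ?_ ?_ ?_ x y z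
  · intro x y z
    simp only [tp, add_comm (z * star y * x), add_comm (δ z * star y * x),
      add_comm (z * star (δ y) * x), add_comm (z * star y * δ x)]
    abel
  · intro x x' y z
    simp only [tp, map_add, add_mul, mul_add, smul_add]
    abel
  · intro x y y' z
    simp only [tp, map_add, star_add, add_mul, mul_add, smul_add]
    abel
  · intro c x y z
    simp only [tp, map_smul, map_add, smul_mul_assoc, mul_smul_comm]
    module
  · intro c x y z
    simp only [tp, map_smul, map_add, star_smul, smul_mul_assoc, mul_smul_comm]
    module
  · intro x
    have outer : tp x x (δ x) = tp (δ x) x x := by simp only [tp, add_comm]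
    simp only [h, outer]
    module
end

section
/- Let H be a complex Hilbert space and M a von Neumann algebra acting on H. Suppose r : M → M is a bounded ℂ-linear map such that for every x ∈ M there exists p_x ∈ M with 0 ≤ p_x and r(x) = x·p_x + p_x·x. Then there exists p ∈ M with 0 ≤ p such that r(x²) = x·r(x) + r(x)·x − x·p·x for every x ∈ M. -/
/-- Scalars of a von Neumann algebra: a `VonNeumannAlgebra H` is closed under `ℂ`-scalar
multiplication (it is a star subalgebra), so its subtype carries a `ℂ`-module structure. -/
instance VonNeumannAlgebra.instSMulMemClass {H : Type*} [NormedAddCommGroup H]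
    [InnerProductSpace ℂ H] [CompleteSpace H] :
    SMulMemClass (VonNeumannAlgebra H) ℂ (H →L[ℂ] H) where
  smul_mem {s} c a ha := s.toStarSubalgebra.smul_mem ha c

theorem CStarAlgebra.norm_le_one_of_neg_one_le_of_le_one {A : Type*} [CStarAlgebra A]
    [PartialOrder A] [StarOrderedRing A] {z : A} (hz : IsSelfAdjoint z) (hl : -1 ≤ z)
    (hu : z ≤ 1) : ‖z‖ ≤ 1 := by
  have hl' : algebraMap ℝ A (-1) ≤ z := by simpa using hl
  have hu' : z ≤ algebraMap ℝ A 1 := by simpa using hu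
  rw [← cfc_id ℝ z]
  refine norm_cfc_le zero_le_one fun t ht => abs_le.2 ⟨?_, ?_⟩
  · exact (algebraMap_le_iff_le_spectrum hz).1 hl' t ht
  · exact (le_algebraMap_iff_spectrum_le hz).1 hu' t ht

/-- If the positive and negative parts of `y` are dominated by `e` and `1 - e`, then subtracting
`2e - 1` from `2y` gives an element of the unit ball. -/
theorem CStarAlgebra.norm_two_smul_sub_le {A : Type*} [CStarAlgebra A]
    [PartialOrder A] [StarOrderedRing A] {y p n e : A} (hp : 0 ≤ p) (hn : 0 ≤ n)
    (hy : y = p - n) (hpe : p ≤ e) (hne : n ≤ 1 - e) :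
    ‖(2 : ℝ) • y - ((2 : ℝ) • e - 1)‖ ≤ 1 := by
  subst hy
  have h2 : IsSelfAdjoint (2 : ℝ) := .all _
  refine norm_le_one_of_neg_one_le_of_le_one ?_ ?_ ?_
  · exact (h2.smul (hp.isSelfAdjoint.sub hn.isSelfAdjoint)).sub
      ((h2.smul (hp.trans hpe).isSelfAdjoint).sub (.one _))
  · have : 0 ≤ (2 : ℝ) • ((1 - e - n) + p) :=
      smul_nonneg zero_le_two (add_nonneg (sub_nonneg.2 hne) hp)
    rw [← sub_nonneg]
    convert this using 1
    module
  · have : 0 ≤ (2 : ℝ) • ((e - p) + n) :=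
      smul_nonneg zero_le_two (add_nonneg (sub_nonneg.2 hpe) hn)
    rw [← sub_nonneg]
    convert this using 1
    module

open CFC in
/-- For a self-adjoint contraction `y` in a von Neumann algebra there is a projection `e` in the
algebra such that `2y - (2e - 1)` is again a contraction. -/
theorem VonNeumannAlgebra.exists_isStarProjection_norm_le {H : Type*} [NormedAddCommGroup H]
    [InnerProductSpace ℂ H] [CompleteSpace H] (N : VonNeumannAlgebra H) {y : H →L[ℂ] H}
    (hyN : y ∈ N) (hy : IsSelfAdjoint y) (hy1 : ‖y‖ ≤ 1) :
    ∃ e ∈ N, IsStarProjection e ∧ ‖(2 : ℝ) • y - ((2 : ℝ) • e - 1)‖ ≤ 1 := by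
  set K : Submodule ℂ H := (y⁻).ker
  set e : H →L[ℂ] H := K.starProjection with he_def
  have he : IsStarProjection e := isStarProjection_starProjection
  have hneg : y⁻ * e = 0 := by
    ext v
    exact LinearMap.mem_ker.1 (K.starProjection_apply_mem v)
  have hneg' : e * y⁻ = 0 := by
    simpa [he.isSelfAdjoint.star_eq, (negPart_nonneg y).isSelfAdjoint.star_eq]
      using congr(star $hneg)
  have hpos : e * y⁺ = y⁺ := by
    ext v
    refine K.starProjection_mem_subspace_eq_self (⟨y⁺ v, LinearMap.mem_ker.2 ?_⟩ : K)
    exact congr($(negPart_mul_posPart y) v)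
  have hpos' : y⁺ * e = y⁺ := by
    simpa [he.isSelfAdjoint.star_eq, (posPart_nonneg y).isSelfAdjoint.star_eq]
      using congr(star $hpos)
  have hpos1 : y⁺ ≤ e := by
    have h1 : y⁺ ≤ 1 := (CStarAlgebra.norm_le_one_iff_of_nonneg _ (posPart_nonneg y)).1
      ((CStarAlgebra.norm_posPart_le y).trans hy1)
    simpa [hpos, hpos', he.isIdempotentElem.eq] using
      he.isSelfAdjoint.conjugate_le_conjugate h1
  have hneg1 : y⁻ ≤ 1 - e := by
    have h1 : y⁻ ≤ 1 := (CStarAlgebra.norm_le_one_iff_of_nonneg _ (negPart_nonneg y)).1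
      ((CStarAlgebra.norm_negPart_le y).trans hy1)
    simpa [sub_mul, mul_sub, hneg, hneg', he.isIdempotentElem.eq] using
      he.one_sub.isSelfAdjoint.conjugate_le_conjugate h1
  refine ⟨e, ?_, he, ?_⟩
  · refine (VonNeumannAlgebra.IsStarProjection.mem_iff he N).2 fun z hz => ?_
    have hc : Commute y⁻ z := by
      have : Commute y z := VonNeumannAlgebra.mem_commutant_iff.1 hz y hyN
      exact this.cfcₙ_real _
    rw [he_def, Submodule.range_starProjection, Module.End.mem_invtSubmodule]
    intro v hv
    have hv' : y⁻ v = 0 := LinearMap.mem_ker.1 hv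
    refine LinearMap.mem_ker.2 ?_
    have := congr($(hc.eq) v)
    simpa [hv'] using this
  · exact CStarAlgebra.norm_two_smul_sub_le (posPart_nonneg y) (negPart_nonneg y)
      (posPart_sub_negPart y).symm hpos1 hneg1

/-- In a von Neumann algebra, self-adjoint elements of the unit ball are norm limits of linear
combinations of projections, with a geometric rate. -/
theorem VonNeumannAlgebra.exists_mem_span_isStarProjection_norm_sub_le {H : Type*}
    [NormedAddCommGroup H] [InnerProductSpace ℂ H] [CompleteSpace H] (M : VonNeumannAlgebra H)
    (n : ℕ) (y : M) (hy : IsSelfAdjoint (y : H →L[ℂ] H)) (hy1 : ‖(y : H →L[ℂ] H)‖ ≤ 1) :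
    ∃ v ∈ Submodule.span ℂ {e : M | IsStarProjection (e : H →L[ℂ] H)},
      ‖(y - v : H →L[ℂ] H)‖ ≤ (1 / 2) ^ n := by
  induction n generalizing y with
  | zero => exact ⟨0, zero_mem _, by simpa using hy1⟩
  | succ n ih =>
    obtain ⟨e, heM, he, hnorm⟩ := M.exists_isStarProjection_norm_le y.2 hy hy1
    lift e to M using heM
    have hcoe : ((y + y - (e + e - 1) : M) : H →L[ℂ] H)
        = (2 : ℝ) • (y : H →L[ℂ] H) - ((2 : ℝ) • (e : H →L[ℂ] H) - 1) := by
      simp [two_smul]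
    have h2 : IsSelfAdjoint (2 : ℝ) := .all _
    obtain ⟨v, hv, hyv⟩ := ih (y + y - (e + e - 1))
      (hcoe ▸ (h2.smul hy).sub ((h2.smul he.isSelfAdjoint).sub (.one _))) (hcoe ▸ hnorm)
    refine ⟨(1 / 2 : ℂ) • v + e - (1 / 2 : ℂ) • 1, ?_, ?_⟩
    · refine sub_mem (add_mem (Submodule.smul_mem _ _ hv) (Submodule.subset_span he))
        (Submodule.smul_mem _ _ (Submodule.subset_span ?_))
      exact IsStarProjection.one _
    · have : (y : H →L[ℂ] H) - ((1 / 2 : ℂ) • v + e - (1 / 2 : ℂ) • 1 : M)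
          = (1 / 2 : ℂ) • (((y + y - (e + e - 1) : M) : H →L[ℂ] H) - v) := by
        push_cast
        module
      rw [this, norm_smul, pow_succ']
      have h12 : ‖(1 / 2 : ℂ)‖ = 1 / 2 := by norm_num
      rw [h12]
      gcongr

/-- The linear span of the projections is norm dense in a von Neumann algebra. -/
theorem VonNeumannAlgebra.dense_span_isStarProjection {H : Type*}
    [NormedAddCommGroup H] [InnerProductSpace ℂ H] [CompleteSpace H] (M : VonNeumannAlgebra H) :
    Dense (Submodule.span ℂ {e : M | IsStarProjection (e : H →L[ℂ] H)} : Set M) := by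
  set V := Submodule.span ℂ {e : M | IsStarProjection (e : H →L[ℂ] H)}
  have hball (y : M) (hy : IsSelfAdjoint (y : H →L[ℂ] H)) (hy1 : ‖(y : H →L[ℂ] H)‖ ≤ 1) :
      y ∈ V.topologicalClosure := by
    refine Metric.mem_closure_iff.2 fun ε hε => ?_
    obtain ⟨n, hn⟩ := exists_pow_lt_of_lt_one hε (by norm_num : (1 / 2 : ℝ) < 1)
    obtain ⟨v, hv, hyv⟩ := M.exists_mem_span_isStarProjection_norm_sub_le n y hy hy1
    refine ⟨v, hv, lt_of_le_of_lt ?_ hn⟩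
    rw [Subtype.dist_eq, dist_eq_norm]
    exact hyv
  have hsa (y : M) (hy : IsSelfAdjoint (y : H →L[ℂ] H)) : y ∈ V.topologicalClosure := by
    rcases eq_or_ne y 0 with rfl | h0
    · exact zero_mem _
    have hnorm : ‖(y : H →L[ℂ] H)‖ ≠ 0 := by simpa using h0
    have hmem := hball (((‖(y : H →L[ℂ] H)‖ : ℂ))⁻¹ • y) ?_ ?_
    · have := V.topologicalClosure.smul_mem (‖(y : H →L[ℂ] H)‖ : ℂ) hmem
      rwa [smul_smul, mul_inv_cancel₀ (by exact_mod_cast hnorm), one_smul] at this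
    · have hs : IsSelfAdjoint ((‖(y : H →L[ℂ] H)‖ : ℂ))⁻¹ := by
        simp [isSelfAdjoint_iff]
      exact hs.smul hy
    · push_cast
      rw [norm_smul, norm_inv, Complex.norm_real, norm_norm, inv_mul_cancel₀ hnorm]
  intro x
  change x ∈ V.topologicalClosure
  let a : M := ⟨x + star (x : H →L[ℂ] H), add_mem x.2 (star_mem x.2)⟩
  let b : M := Complex.I • ⟨x - star (x : H →L[ℂ] H), sub_mem x.2 (star_mem x.2)⟩
  have ha : IsSelfAdjoint (a : H →L[ℂ] H) := IsSelfAdjoint.add_star_self _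
  have hb : IsSelfAdjoint (b : H →L[ℂ] H) := by
    change star (Complex.I • ((x : H →L[ℂ] H) - star (x : H →L[ℂ] H))) = Complex.I • _
    rw [star_smul, star_sub, star_star, Complex.star_def, Complex.conj_I, neg_smul, ← smul_neg,
      neg_sub]
  have hx : x = (1 / 2 : ℂ) • a + (-Complex.I / 2 : ℂ) • b := by
    ext1
    change (x : H →L[ℂ] H) = (1 / 2 : ℂ) • (x + star (x : H →L[ℂ] H))
      + (-Complex.I / 2 : ℂ) • Complex.I • ((x : H →L[ℂ] H) - star (x : H →L[ℂ] H))
    have hI : -Complex.I / 2 * Complex.I = 1 / 2 := by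
      rw [div_mul_eq_mul_div, neg_mul, Complex.I_mul_I, neg_neg]
    rw [smul_smul, hI]
    module
  rw [hx]
  exact add_mem (Submodule.smul_mem _ _ (hsa a ha)) (Submodule.smul_mem _ _ (hsa b hb))

/-- An additive map satisfying the locality condition `u x = 0 = x v → u r(x) v = 0` satisfies the
generalized Leibniz rule on idempotents. -/
theorem AddMonoidHom.map_mul_of_isIdempotentElem {A : Type*} [Ring A] (r : A →+ A)
    (hr : ∀ u x v, u * x = 0 → x * v = 0 → u * r x * v = 0) {e f : A}
    (he : IsIdempotentElem e) (hf : IsIdempotentElem f) :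
    r (e * f) = e * r f + r e * f - e * r 1 * f := by
  have h1 : (1 - e) * r (e * f) * (1 - f) = 0 := by
    apply hr
    · rw [← mul_assoc, he.one_sub_mul_self, zero_mul]
    · rw [mul_assoc, hf.mul_one_sub_self, mul_zero]
  have h2 : (1 - e) * r (e * (1 - f)) * f = 0 := by
    apply hr
    · rw [← mul_assoc, he.one_sub_mul_self, zero_mul]
    · rw [mul_assoc, hf.one_sub_mul_self, mul_zero]
  have h3 : e * r ((1 - e) * f) * (1 - f) = 0 := by
    apply hr
    · rw [← mul_assoc, he.mul_one_sub_self, zero_mul]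
    · rw [mul_assoc, hf.mul_one_sub_self, mul_zero]
  have h4 : e * r ((1 - e) * (1 - f)) * f = 0 := by
    apply hr
    · rw [← mul_assoc, he.mul_one_sub_self, zero_mul]
    · rw [mul_assoc, hf.one_sub_mul_self, mul_zero]
  have key : r (e * f) - (e * r f + r e * f - e * r 1 * f) =
      (1 - e) * r (e * f) * (1 - f) - (1 - e) * r (e * (1 - f)) * f
        - e * r ((1 - e) * f) * (1 - f) + e * r ((1 - e) * (1 - f)) * f := by
    simp only [sub_mul, mul_sub, one_mul, mul_one, map_sub, mul_assoc]
    abel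
  rw [h1, h2, h3, h4] at key
  simpa [sub_eq_zero] using key

/-- If `r` is a bounded linear map on a von Neumann algebra `M` such that for every `x`
there is `p_x ≥ 0` with `r(x) = x p_x + p_x x`, then there is `p ≥ 0` such that
`r(x²) = x r(x) + r(x) x − x p x` for every `x`.  (Positivity `0 ≤ ·` is taken in the
canonical order on the C*-algebra of bounded operators, i.e. the Loewner order.) -/
theorem bounded_map_pos_multiplier
    {H : Type*} [NormedAddCommGroup H] [InnerProductSpace ℂ H] [CompleteSpace H]
    (M : VonNeumannAlgebra H)
    (r : M →L[ℂ] M)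
    (h : ∀ x : M, ∃ p : M, 0 ≤ (p : H →L[ℂ] H) ∧ r x = x * p + p * x) :
    ∃ p : M, 0 ≤ (p : H →L[ℂ] H) ∧
      ∀ x : M, r (x * x) = x * r x + r x * x - x * p * x := by
  have hr (u x v : M) (hux : u * x = 0) (hxv : x * v = 0) : u * r x * v = 0 := by
    obtain ⟨p, -, hp⟩ := h x
    rw [hp, mul_add, add_mul, ← mul_assoc, hux, mul_assoc u, mul_assoc p, hxv]
    simp
  have hidem {e : M} (he : IsStarProjection (e : H →L[ℂ] H)) : IsIdempotentElem e :=
    Subtype.ext he.isIdempotentElem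
  have hspan : ∀ x ∈ Submodule.span ℂ {e : M | IsStarProjection (e : H →L[ℂ] H)},
      ∀ y ∈ Submodule.span ℂ {e : M | IsStarProjection (e : H →L[ℂ] H)},
      r (x * y) = x * r y + r x * y - x * r 1 * y := by
    intro x hx y hy
    induction hx, hy using Submodule.span_induction₂ with
    | mem_mem x y hx hy => exact (r : M →+ M).map_mul_of_isIdempotentElem hr (hidem hx) (hidem hy)
    | zero_left y hy => simp
    | zero_right x hx => simp
    | add_left x x' y _ _ _ hx hx' =>
      simp only [add_mul, map_add, hx, hx']
      abel
    | add_right x y y' _ _ _ hy hy' =>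
      simp only [mul_add, map_add, hy, hy']
      abel
    | smul_left c x y _ _ hx => simp only [smul_mul_assoc, map_smul, hx, smul_sub, smul_add]
    | smul_right c x y _ _ hy => simp only [mul_smul_comm, map_smul, hy, smul_sub, smul_add]
  obtain ⟨p, hp, hp1⟩ := h 1
  rw [one_mul, mul_one] at hp1
  refine ⟨r 1, ?_, fun x => ?_⟩
  · rw [hp1]
    exact add_nonneg hp hp
  · have hclosed : IsClosed {x : M | r (x * x) = x * r x + r x * x - x * r 1 * x} :=
      isClosed_eq (by fun_prop) (by fun_prop)
    exact hclosed.closure_subset_iff.2 (fun x hx => hspan x hx x hx)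
      (M.dense_span_isStarProjection x)
end
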